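/- Let x² = (1+i,1,1,1) ∈ ℂ⁴. Then ν(x², conj x²) ≠ 0, Â(x², conj x²) and H(x²) := Ĥ(x², conj x²) are invertible, all partial derivatives ∂_α Ĥ, ∂̄_β Ĥ, ∂_α∂̄_β Ĥ (1 ≤ α,β ≤ 4) exist at (x², conj x²), and the mean-curvature matrix satisfies K(x²) = [[2, −217/25992],[−217/25992, 2]]; in particular K(x²) ≠ 2·I₂, so the natural metric of the Horrocks–Mumford bundle twist E(−2) does not satisfy the Hermitian–Einstein equation K = 2·id at x². -/

import Mathlib

open Matrix

noncomputable section

/-- ν(x,y) = 1 + Σ x_i y_i, the polarization of n(x) = 1 + Σ |x_i|². -/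
def nu (x y : Fin 4 → ℂ) : ℂ := 1 + ∑ i, x i * y i

/-- The pointwise conjugate vector, y = conj x. -/
def cconj (x : Fin 4 → ℂ) : Fin 4 → ℂ := fun i => star (x i)

/-- Â(x,y), the polarization of the 5×5 matrix A(x): every |x_i|² is replaced
by x_i·y_i and every conj(x_i) by y_i, so that Â(x, conj x) = A(x).
Here x 0,…,x 3 stand for x₁,…,x₄. -/
def Ahat (x y : Fin 4 → ℂ) : Matrix (Fin 5) (Fin 5) ℂ :=
  !![nu x y + 1, y 1 * x 3, y 3 * x 2, y 0 * x 1, y 2 * x 0;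
     y 3 * x 1, nu x y + x 0 * y 0, y 2, x 3, y 1 * x 2;
     y 2 * x 3, x 2, nu x y + x 1 * y 1, y 3 * x 0, y 0;
     y 1 * x 0, y 3, y 0 * x 3, nu x y + x 2 * y 2, x 1;
     y 0 * x 2, y 2 * x 1, x 0, y 1, nu x y + x 3 * y 3]

/-- B̂(x,y), the polarization of the 5×2 matrix B(x), with B̂(x, conj x) = B(x). -/
def Bhat (x y : Fin 4 → ℂ) : Matrix (Fin 5) (Fin 2) ℂ :=
  !![(x 0 * y 0 + x 3 * y 3) * y 1 * y 2, -(x 1 * y 1 + x 2 * y 2) * y 0 * y 3;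
     (1 + x 1 * y 1) * y 2 * y 3, -(x 2 * y 2 + x 3 * y 3) * y 1;
     (x 0 * y 0 + x 2 * y 2) * y 3, -(1 + x 3 * y 3) * y 0 * y 2;
     (x 1 * y 1 + x 3 * y 3) * y 0, -(1 + x 0 * y 0) * y 1 * y 3;
     (1 + x 2 * y 2) * y 0 * y 1, -(x 0 * y 0 + x 1 * y 1) * y 2]

/-- Ĉ(x,y) = diag(ĉ₁,ĉ₂), the polarization of C(x), with Ĉ(x, conj x) = C(x). -/
def Chat (x y : Fin 4 → ℂ) : Matrix (Fin 2) (Fin 2) ℂ :=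
  !![x 0 * y 0 * (x 1 * y 1) * (1 + x 2 * y 2) + x 0 * y 0 * (x 3 * y 3)
       + x 2 * y 2 * (x 3 * y 3) * (1 + x 1 * y 1), 0;
     0, x 0 * y 0 * (x 2 * y 2) * (1 + x 3 * y 3) + x 1 * y 1 * (x 2 * y 2)
       + x 1 * y 1 * (x 3 * y 3) * (1 + x 0 * y 0)]

/-- B̂*(x,y) := (B̂(y,x))ᵀ, so that B̂*(x, conj x) = conj(B(x))ᵀ. -/
def BhatStar (x y : Fin 4 → ℂ) : Matrix (Fin 2) (Fin 5) ℂ := (Bhat y x)ᵀ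

/-- Ĥ(x,y) = ν(x,y)⁻¹ · (Ĉ(x,y) − B̂*(x,y)·Â(x,y)⁻¹·B̂(x,y)); Ĥ(x, conj x) is the
matrix H(x) of the natural metric of E(−2) in the frame (ã₁,ã₂). -/
def Hhat (x y : Fin 4 → ℂ) : Matrix (Fin 2) (Fin 2) ℂ :=
  (nu x y)⁻¹ • (Chat x y - BhatStar x y * (Ahat x y)⁻¹ * Bhat x y)

/-- ∂_α Ĥ : the complex derivative of t ↦ Ĥ(x + t·e_α, y)_{ij} at t = 0. -/
def dH (α : Fin 4) (x y : Fin 4 → ℂ) (i j : Fin 2) : ℂ :=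
  deriv (fun t : ℂ => Hhat (x + t • (Pi.single α 1 : Fin 4 → ℂ)) y i j) 0

/-- ∂̄_β Ĥ : the complex derivative of s ↦ Ĥ(x, y + s·e_β)_{ij} at s = 0. -/
def dbH (β : Fin 4) (x y : Fin 4 → ℂ) (i j : Fin 2) : ℂ :=
  deriv (fun s : ℂ => Hhat x (y + s • (Pi.single β 1 : Fin 4 → ℂ)) i j) 0

/-- ∂_α ∂̄_β Ĥ : the mixed second derivative. -/
def ddH (α β : Fin 4) (x y : Fin 4 → ℂ) (i j : Fin 2) : ℂ :=
  deriv (fun s : ℂ => dH α x (y + s • (Pi.single β 1 : Fin 4 → ℂ)) i j) 0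

/-- g^{βα}(x) = n(x)·(δ_{αβ} + conj(x_β)·x_α), the inverse Fubini–Study
coefficients in the standard affine chart. -/
def gUp (x : Fin 4 → ℂ) (β α : Fin 4) : ℂ :=
  nu x (cconj x) * ((if α = β then 1 else 0) + star (x β) * x α)

/-- The mean-curvature matrix K(x) of the natural metric of E(−2) with respect
to the Fubini–Study metric:
K_{ij} = −Σ_{α,β} g^{βα}·( Σ_k ∂_α∂̄_β Ĥ_{ik}·(H⁻¹)_{kj}
                           − Σ_{k,l,m} ∂_α Ĥ_{ik}·(H⁻¹)_{kl}·∂̄_β Ĥ_{lm}·(H⁻¹)_{mj} ),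
all derivatives evaluated at (x, conj x) and H = Ĥ(x, conj x). -/
def Kmat (x : Fin 4 → ℂ) : Matrix (Fin 2) (Fin 2) ℂ :=
  Matrix.of fun i j =>
    -∑ α : Fin 4, ∑ β : Fin 4, gUp x β α *
      ((∑ k : Fin 2, ddH α β x (cconj x) i k * (Hhat x (cconj x))⁻¹ k j)
        - ∑ k : Fin 2, ∑ l : Fin 2, ∑ m : Fin 2,
            dH α x (cconj x) i k * (Hhat x (cconj x))⁻¹ k l *
              dbH β x (cconj x) l m * (Hhat x (cconj x))⁻¹ m j)


section generic

variable {R : Type*} [CommRing R]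

def nuR (x y : Fin 4 → R) : R := 1 + ∑ i, x i * y i

def AR (x y : Fin 4 → R) : Matrix (Fin 5) (Fin 5) R :=
  !![nuR x y + 1, y 1 * x 3, y 3 * x 2, y 0 * x 1, y 2 * x 0;
     y 3 * x 1, nuR x y + x 0 * y 0, y 2, x 3, y 1 * x 2;
     y 2 * x 3, x 2, nuR x y + x 1 * y 1, y 3 * x 0, y 0;
     y 1 * x 0, y 3, y 0 * x 3, nuR x y + x 2 * y 2, x 1;
     y 0 * x 2, y 2 * x 1, x 0, y 1, nuR x y + x 3 * y 3]

def BR (x y : Fin 4 → R) : Matrix (Fin 5) (Fin 2) R :=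
  !![(x 0 * y 0 + x 3 * y 3) * y 1 * y 2, -(x 1 * y 1 + x 2 * y 2) * y 0 * y 3;
     (1 + x 1 * y 1) * y 2 * y 3, -(x 2 * y 2 + x 3 * y 3) * y 1;
     (x 0 * y 0 + x 2 * y 2) * y 3, -(1 + x 3 * y 3) * y 0 * y 2;
     (x 1 * y 1 + x 3 * y 3) * y 0, -(1 + x 0 * y 0) * y 1 * y 3;
     (1 + x 2 * y 2) * y 0 * y 1, -(x 0 * y 0 + x 1 * y 1) * y 2]

def CR (x y : Fin 4 → R) : Matrix (Fin 2) (Fin 2) R :=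
  !![x 0 * y 0 * (x 1 * y 1) * (1 + x 2 * y 2) + x 0 * y 0 * (x 3 * y 3)
       + x 2 * y 2 * (x 3 * y 3) * (1 + x 1 * y 1), 0;
     0, x 0 * y 0 * (x 2 * y 2) * (1 + x 3 * y 3) + x 1 * y 1 * (x 2 * y 2)
       + x 1 * y 1 * (x 3 * y 3) * (1 + x 0 * y 0)]

def DR (x y : Fin 4 → R) : Matrix (Fin 2) (Fin 5) R := (BR y x)ᵀ

/-- unit shift in direction `α` -/
def sh (α : Fin 4) (x : Fin 4 → R) : Fin 4 → R := x + Pi.single α 1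

/-- difference in the first variable -/
def dx {M : Type*} [Sub M] (α : Fin 4) (F : (Fin 4 → R) → (Fin 4 → R) → M) (x y : Fin 4 → R) : M :=
  F (sh α x) y - F x y

/-- difference in the second variable -/
def dy {M : Type*} [Sub M] (β : Fin 4) (F : (Fin 4 → R) → (Fin 4 → R) → M) (x y : Fin 4 → R) : M :=
  F x (sh β y) - F x y

/-- first derivative of `C - D A⁻¹ B` -/
def N1 (C1 : Matrix (Fin 2) (Fin 2) R) (D1 V : Matrix (Fin 2) (Fin 5) R)
    (A1 : Matrix (Fin 5) (Fin 5) R) (B1 U : Matrix (Fin 5) (Fin 2) R) : Matrix (Fin 2) (Fin 2) R :=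
  C1 - D1 * U - V * (B1 - A1 * U)

/-- mixed second derivative of `C - D A⁻¹ B` -/
def N12 (C12 : Matrix (Fin 2) (Fin 2) R) (D1 D12 V V2 : Matrix (Fin 2) (Fin 5) R)
    (A1 A12 : Matrix (Fin 5) (Fin 5) R) (B1 B12 U U2 : Matrix (Fin 5) (Fin 2) R) :
    Matrix (Fin 2) (Fin 2) R :=
  C12 - (D12 * U + D1 * U2) - (V2 * (B1 - A1 * U) + V * (B12 - (A12 * U + A1 * U2)))

end generic

lemma Ahat_eq : Ahat = AR (R := ℂ) := rfl
lemma Bhat_eq : Bhat = BR (R := ℂ) := rfl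
lemma Chat_eq : Chat = CR (R := ℂ) := rfl
lemma Dhat_eq : BhatStar = DR (R := ℂ) := rfl
lemma nu_eq : nu = nuR (R := ℂ) := rfl

section affine

variable (α : Fin 4) (t : ℂ) (x y : Fin 4 → ℂ)

lemma nu_x : nuR (x + t • Pi.single α 1) y = nuR x y + t * dx α nuR x y := by
  simp only [dx, sh]
  generalize (Pi.single α 1 : Fin 4 → ℂ) = e
  simp [nuR, Fin.sum_univ_four]; ring

lemma nu_y : nuR x (y + t • Pi.single α 1) = nuR x y + t * dy α nuR x y := by
  simp only [dy, sh]
  generalize (Pi.single α 1 : Fin 4 → ℂ) = e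
  simp [nuR, Fin.sum_univ_four]; ring

lemma B_x : BR (x + t • Pi.single α 1) y = BR x y + t • dx α BR x y := by
  simp only [dx, sh]
  generalize (Pi.single α 1 : Fin 4 → ℂ) = e
  ext i j
  fin_cases i <;> fin_cases j <;> simp [BR] <;> ring

set_option maxHeartbeats 1600000 in
lemma B_y : BR x (y + t • Pi.single α 1) = BR x y + t • dy α BR x y := by
  ext i j
  fin_cases α <;> fin_cases i <;> fin_cases j <;> simp [BR, dy, sh] <;> ring

lemma C_x : CR (x + t • Pi.single α 1) y = CR x y + t • dx α CR x y := by
  ext i j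
  fin_cases α <;> fin_cases i <;> fin_cases j <;> simp [CR, dx, sh] <;> ring

lemma C_y : CR x (y + t • Pi.single α 1) = CR x y + t • dy α CR x y := by
  ext i j
  fin_cases α <;> fin_cases i <;> fin_cases j <;> simp [CR, dy, sh] <;> ring

lemma D_x : DR (x + t • Pi.single α 1) y = DR x y + t • dx α DR x y := by
  simp only [DR, dx, B_y]; ext i j; simp [dy, sh]

lemma D_y : DR x (y + t • Pi.single α 1) = DR x y + t • dy α DR x y := by
  simp only [DR, dy, B_x]; ext i j; simp [dx, sh]

lemma A_x : AR (x + t • Pi.single α 1) y = AR x y + t • dx α AR x y := by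
  simp only [dx, sh]
  generalize (Pi.single α 1 : Fin 4 → ℂ) = e
  ext i j
  fin_cases i <;> fin_cases j <;> simp [AR, nuR, Fin.sum_univ_four] <;> ring

lemma A_y : AR x (y + t • Pi.single α 1) = AR x y + t • dy α AR x y := by
  simp only [dy, sh]
  generalize (Pi.single α 1 : Fin 4 → ℂ) = e
  ext i j
  fin_cases i <;> fin_cases j <;> simp [AR, nuR, Fin.sum_univ_four] <;> ring

end affine

section derivative

variable {m n p : Type*}

/-- entrywise derivative of a matrix-valued function -/
def MD (F : ℂ → Matrix m n ℂ) (F' : Matrix m n ℂ) (t : ℂ) : Prop :=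
  ∀ i j, HasDerivAt (fun t => F t i j) (F' i j) t

lemma MD.sub {F G : ℂ → Matrix m n ℂ} {F' G' : Matrix m n ℂ} {t : ℂ} (hF : MD F F' t)
    (hG : MD G G' t) : MD (fun t => F t - G t) (F' - G') t :=
  fun i j => (hF i j).fun_sub (hG i j)

lemma MD.affine (F F' : Matrix m n ℂ) (t : ℂ) : MD (fun t => F + t • F') F' t := by
  intro i j
  simpa using ((hasDerivAt_id t).mul_const (F' i j)).const_add (F i j)

lemma MD.mul [Fintype n] {F : ℂ → Matrix m n ℂ} {G : ℂ → Matrix n p ℂ} {F' : Matrix m n ℂ}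
    {G' : Matrix n p ℂ} {t : ℂ} (hF : MD F F' t) (hG : MD G G' t) :
    MD (fun t => F t * G t) (F' * G t + F t * G') t := by
  intro i j
  have := HasDerivAt.fun_sum (u := Finset.univ) (fun k _ => (hF i k).fun_mul (hG k j))
  simpa [Matrix.mul_apply, Finset.sum_add_distrib] using this

lemma MD.smul {a : ℂ → ℂ} {F : ℂ → Matrix m n ℂ} {a' : ℂ} {F' : Matrix m n ℂ} {t : ℂ}
    (ha : HasDerivAt a a' t) (hF : MD F F' t) :
    MD (fun t => a t • F t) (a' • F t + a t • F') t := by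
  intro i j
  simpa using ha.fun_mul (hF i j)

lemma MD.congr {F G : ℂ → Matrix m n ℂ} {F' G' : Matrix m n ℂ} {t : ℂ} (hF : MD F F' t)
    (h : G =ᶠ[nhds t] F) (h' : F' = G') : MD G G' t := by
  intro i j
  subst h'
  exact (hF i j).congr_of_eventuallyEq (h.mono fun s hs => by simp [hs])

lemma det_diff [Fintype n] [DecidableEq n] {F : ℂ → Matrix n n ℂ} {t : ℂ}
    (hF : ∀ i j, DifferentiableAt ℂ (fun t => F t i j) t) :
    DifferentiableAt ℂ (fun t => (F t).det) t := by
  simp only [Matrix.det_apply]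
  refine DifferentiableAt.fun_sum fun σ _ => ?_
  refine DifferentiableAt.const_smul ?_ _
  exact DifferentiableAt.fun_finsetProd fun i _ => hF _ _

lemma MD.inv [Fintype n] [DecidableEq n] {F : ℂ → Matrix n n ℂ} {F' : Matrix n n ℂ} {t : ℂ} (hF : MD F F' t)
    (h0 : (F t).det ≠ 0) :
    MD (fun t => (F t)⁻¹) (-((F t)⁻¹ * F' * (F t)⁻¹)) t := by
  have hd := det_diff (fun i j => (hF i j).differentiableAt)
  have hev : ∀ᶠ s in nhds t, (F s).det ≠ 0 := hd.continuousAt.eventually_ne h0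
  have hdiff : ∀ i j, DifferentiableAt ℂ (fun t => (F t)⁻¹ i j) t := by
    intro i j
    simp only [Matrix.inv_def, Matrix.smul_apply, smul_eq_mul, Ring.inverse_eq_inv']
    refine (hd.fun_inv h0).fun_mul ?_
    simp only [Matrix.adjugate_apply]
    refine det_diff fun k l => ?_
    by_cases hk : k = j
    · subst hk; simp
    · simpa [Matrix.updateRow_apply, hk] using (hF k l).differentiableAt
  obtain ⟨G, hG⟩ : ∃ G, MD (fun t => (F t)⁻¹) G t :=
    ⟨fun i j => deriv (fun t => (F t)⁻¹ i j) t, fun i j => (hdiff i j).hasDerivAt⟩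
  have h1 := hF.mul hG
  have h2 : F' * (F t)⁻¹ + F t * G = 0 := by
    ext i j
    refine (h1 i j).unique ?_
    refine (hasDerivAt_const t ((1 : Matrix n n ℂ) i j)).congr_of_eventuallyEq ?_
    filter_upwards [hev] with s hs
    rw [Matrix.mul_nonsing_inv _ (isUnit_iff_ne_zero.2 hs)]
  have h3 : G = -((F t)⁻¹ * F' * (F t)⁻¹) := by
    have h4 : (F t)⁻¹ * (F t * G) = G :=
      Matrix.nonsing_inv_mul_cancel_left _ _ (isUnit_iff_ne_zero.2 h0)
    rw [← h4, eq_neg_of_add_eq_zero_right h2, Matrix.mul_neg, Matrix.mul_assoc]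
  rwa [h3] at hG

end derivative

section Hderiv

variable {nf : ℂ → ℂ} {A : ℂ → Matrix (Fin 5) (Fin 5) ℂ} {B : ℂ → Matrix (Fin 5) (Fin 2) ℂ}
  {C : ℂ → Matrix (Fin 2) (Fin 2) ℂ} {D : ℂ → Matrix (Fin 2) (Fin 5) ℂ}
  {n1 : ℂ} {A1 : Matrix (Fin 5) (Fin 5) ℂ} {B1 : Matrix (Fin 5) (Fin 2) ℂ}
  {C1 : Matrix (Fin 2) (Fin 2) ℂ} {D1 : Matrix (Fin 2) (Fin 5) ℂ} {t : ℂ}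

lemma MD_U (hA : MD A A1 t) (hB : MD B B1 t) (h0 : (A t).det ≠ 0) :
    MD (fun t => (A t)⁻¹ * B t) ((A t)⁻¹ * (B1 - A1 * ((A t)⁻¹ * B t))) t := by
  refine ((hA.inv h0).mul hB).congr (Filter.EventuallyEq.refl _ _) ?_
  simp only [Matrix.mul_sub, Matrix.neg_mul, Matrix.mul_assoc]
  abel

lemma MD_V (hA : MD A A1 t) (hD : MD D D1 t) (h0 : (A t).det ≠ 0) :
    MD (fun t => D t * (A t)⁻¹) ((D1 - D t * (A t)⁻¹ * A1) * (A t)⁻¹) t := by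
  refine (hD.mul (hA.inv h0)).congr (Filter.EventuallyEq.refl _ _) ?_
  simp only [Matrix.sub_mul, Matrix.mul_neg, Matrix.mul_assoc]
  abel

lemma MD_N (hA : MD A A1 t) (hB : MD B B1 t) (hC : MD C C1 t) (hD : MD D D1 t)
    (h0 : (A t).det ≠ 0) :
    MD (fun t => C t - D t * (A t)⁻¹ * B t)
      (N1 C1 D1 (D t * (A t)⁻¹) A1 B1 ((A t)⁻¹ * B t)) t := by
  have := hC.sub (hD.mul (MD_U hA hB h0))
  refine this.congr (Filter.Eventually.of_forall fun s => by simp only [Matrix.mul_assoc]) ?_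
  simp only [N1, Matrix.mul_assoc]
  abel

lemma MD_H (hn : HasDerivAt nf n1 t) (hA : MD A A1 t) (hB : MD B B1 t) (hC : MD C C1 t)
    (hD : MD D D1 t) (hn0 : nf t ≠ 0) (h0 : (A t).det ≠ 0) :
    MD (fun t => (nf t)⁻¹ • (C t - D t * (A t)⁻¹ * B t))
      ((nf t)⁻¹ • N1 C1 D1 (D t * (A t)⁻¹) A1 B1 ((A t)⁻¹ * B t)
        - ((nf t)⁻¹ * (nf t)⁻¹ * n1) • (C t - D t * (A t)⁻¹ * B t)) t := by
  refine (MD.smul (hn.fun_inv hn0) (MD_N hA hB hC hD h0)).congr (Filter.EventuallyEq.refl _ _) ?_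
  ext i j
  simp
  field_simp
  ring

end Hderiv

/-- `A⁻¹ B` -/
def Uc (x y : Fin 4 → ℂ) : Matrix (Fin 5) (Fin 2) ℂ := (AR x y)⁻¹ * BR x y

/-- `D A⁻¹` -/
def Vc (x y : Fin 4 → ℂ) : Matrix (Fin 2) (Fin 5) ℂ := DR x y * (AR x y)⁻¹

def Nc (x y : Fin 4 → ℂ) : Matrix (Fin 2) (Fin 2) ℂ := CR x y - DR x y * (AR x y)⁻¹ * BR x y

def N1c (α : Fin 4) (x y : Fin 4 → ℂ) : Matrix (Fin 2) (Fin 2) ℂ :=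
  N1 (dx α CR x y) (dx α DR x y) (Vc x y) (dx α AR x y) (dx α BR x y) (Uc x y)

def N2c (β : Fin 4) (x y : Fin 4 → ℂ) : Matrix (Fin 2) (Fin 2) ℂ :=
  N1 (dy β CR x y) (dy β DR x y) (Vc x y) (dy β AR x y) (dy β BR x y) (Uc x y)

def U2c (β : Fin 4) (x y : Fin 4 → ℂ) : Matrix (Fin 5) (Fin 2) ℂ :=
  (AR x y)⁻¹ * (dy β BR x y - dy β AR x y * Uc x y)

def V2c (β : Fin 4) (x y : Fin 4 → ℂ) : Matrix (Fin 2) (Fin 5) ℂ :=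
  (dy β DR x y - Vc x y * dy β AR x y) * (AR x y)⁻¹

def N12c (α β : Fin 4) (x y : Fin 4 → ℂ) : Matrix (Fin 2) (Fin 2) ℂ :=
  N12 (dy β (dx α CR) x y) (dx α DR x y) (dy β (dx α DR) x y) (Vc x y) (V2c β x y)
    (dx α AR x y) (dy β (dx α AR) x y) (dx α BR x y) (dy β (dx α BR) x y) (Uc x y) (U2c β x y)

lemma Hhat_eq (x y : Fin 4 → ℂ) : Hhat x y = (nuR x y)⁻¹ • Nc x y := rfl

section affine2

variable (α β : Fin 4) (x y : Fin 4 → ℂ)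

lemma MD_x {m n : Type*} (F : (Fin 4 → ℂ) → (Fin 4 → ℂ) → Matrix m n ℂ)
    (h : ∀ t : ℂ, F (x + t • Pi.single α 1) y = F x y + t • dx α F x y) :
    MD (fun t => F (x + t • Pi.single α 1) y) (dx α F x y) 0 := by
  simp only [h]; exact MD.affine _ _ _

lemma MD_y {m n : Type*} (F : (Fin 4 → ℂ) → (Fin 4 → ℂ) → Matrix m n ℂ)
    (h : ∀ t : ℂ, F x (y + t • Pi.single β 1) = F x y + t • dy β F x y) :
    MD (fun t => F x (y + t • Pi.single β 1)) (dy β F x y) 0 := by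
  simp only [h]; exact MD.affine _ _ _

lemma MD_xy {m n : Type*} (F : (Fin 4 → ℂ) → (Fin 4 → ℂ) → Matrix m n ℂ)
    (h : ∀ (t : ℂ) x, F x (y + t • Pi.single β 1) = F x y + t • dy β F x y) :
    MD (fun t => dx α F x (y + t • Pi.single β 1)) (dy β (dx α F) x y) 0 := by
  refine MD_y β x y (dx α F) fun t => ?_
  simp only [dx, h, dy]
  ext i j; simp; ring

lemma nd_x : HasDerivAt (fun t : ℂ => nuR (x + t • Pi.single α 1) y) (dx α nuR x y) 0 := by
  simp only [nu_x]
  simpa using ((hasDerivAt_id (0 : ℂ)).mul_const (dx α nuR x y)).const_add (nuR x y)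

lemma nd_y : HasDerivAt (fun t : ℂ => nuR x (y + t • Pi.single β 1)) (dy β nuR x y) 0 := by
  simp only [nu_y]
  simpa using ((hasDerivAt_id (0 : ℂ)).mul_const (dy β nuR x y)).const_add (nuR x y)

lemma nd_xy : HasDerivAt (fun t : ℂ => dx α nuR x (y + t • Pi.single β 1))
    (dy β (dx α nuR) x y) 0 := by
  have h := (nd_y β (sh α x) y).fun_sub (nd_y β x y)
  refine h.congr_deriv ?_
  simp only [dy, dx]; ring

end affine2

section main

variable {x y : Fin 4 → ℂ} (α β : Fin 4)

lemma MD_Hx (hn : nuR x y ≠ 0) (hA : (AR x y).det ≠ 0) :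
    MD (fun t => Hhat (x + t • Pi.single α 1) y)
      ((nuR x y)⁻¹ • N1c α x y - ((nuR x y)⁻¹ * (nuR x y)⁻¹ * dx α nuR x y) • Nc x y) 0 := by
  have := MD_H (nd_x α x y) (MD_x α x y AR fun t => A_x α t x y) (MD_x α x y BR fun t => B_x α t x y)
    (MD_x α x y CR fun t => C_x α t x y) (MD_x α x y DR fun t => D_x α t x y)
    (by simpa using hn) (by simpa using hA)
  simp only [zero_smul, add_zero] at this
  exact this

lemma MD_Hy (hn : nuR x y ≠ 0) (hA : (AR x y).det ≠ 0) :
    MD (fun t => Hhat x (y + t • Pi.single β 1))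
      ((nuR x y)⁻¹ • N2c β x y - ((nuR x y)⁻¹ * (nuR x y)⁻¹ * dy β nuR x y) • Nc x y) 0 := by
  have := MD_H (nd_y β x y) (MD_y β x y AR fun t => A_y β t x y) (MD_y β x y BR fun t => B_y β t x y)
    (MD_y β x y CR fun t => C_y β t x y) (MD_y β x y DR fun t => D_y β t x y)
    (by simpa using hn) (by simpa using hA)
  simp only [zero_smul, add_zero] at this
  exact this

lemma dH_eq (hn : nuR x y ≠ 0) (hA : (AR x y).det ≠ 0) :
    (dH α x y : Matrix (Fin 2) (Fin 2) ℂ) =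
      (nuR x y)⁻¹ • N1c α x y - ((nuR x y)⁻¹ * (nuR x y)⁻¹ * dx α nuR x y) • Nc x y := by
  ext i j
  exact (MD_Hx α hn hA i j).deriv

lemma MD_Hxy (hn : nuR x y ≠ 0) (hA : (AR x y).det ≠ 0) :
    MD (fun s => dH α x (y + s • Pi.single β 1))
      ((nuR x y)⁻¹ • N12c α β x y
        - ((nuR x y)⁻¹ * (nuR x y)⁻¹) • (dy β nuR x y • N1c α x y + dx α nuR x y • N2c β x y)
        + (2 * (nuR x y)⁻¹ * (nuR x y)⁻¹ * (nuR x y)⁻¹ * dx α nuR x y * dy β nuR x y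
          - (nuR x y)⁻¹ * (nuR x y)⁻¹ * dy β (dx α nuR) x y) • Nc x y) 0 := by
  have mA := MD_y β x y AR fun t => A_y β t x y
  have mB := MD_y β x y BR fun t => B_y β t x y
  have mC := MD_y β x y CR fun t => C_y β t x y
  have mD := MD_y β x y DR fun t => D_y β t x y
  have h0 : (AR x (y + (0 : ℂ) • Pi.single β 1)).det ≠ 0 := by simpa using hA
  have hn0 : nuR x (y + (0 : ℂ) • Pi.single β 1) ≠ 0 := by simpa using hn
  have mU := MD_U mA mB h0
  have mV := MD_V mA mD h0
  have mN := MD_N mA mB mC mD h0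
  have mN1 := ((MD_xy α β x y CR fun t x => C_y β t x y).sub
    ((MD_xy α β x y DR fun t x => D_y β t x y).mul mU)).sub
    (mV.mul ((MD_xy α β x y BR fun t x => B_y β t x y).sub
      ((MD_xy α β x y AR fun t x => A_y β t x y).mul mU)))
  have mi := (nd_y β x y).fun_inv hn0
  have key := (MD.smul mi mN1).sub (MD.smul ((mi.fun_mul mi).fun_mul (nd_xy α β x y)) mN)
  refine key.congr ?_ ?_
  · have e1 : ∀ᶠ s in nhds (0 : ℂ), nuR x (y + s • Pi.single β 1) ≠ 0 :=
      (nd_y β x y).continuousAt.eventually_ne hn0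
    have e2 : ∀ᶠ s in nhds (0 : ℂ), (AR x (y + s • Pi.single β 1)).det ≠ 0 :=
      (det_diff fun i j => (mA i j).differentiableAt).continuousAt.eventually_ne h0
    filter_upwards [e1, e2] with s h1 h2
    rw [dH_eq α h1 h2]
    rfl
  · simp only [zero_smul, add_zero]
    change _ • N1c α x y + _ • N12c α β x y - (_ • Nc x y + _ • N2c β x y) = _
    ext i j
    simp
    field_simp
    ring

end main

/-- Gaussian rationals, a computable model of ℚ(i). -/
abbrev QI := QuadraticAlgebra ℚ (-1) 0

def xq : Fin 4 → QI := ![⟨1, 1⟩, ⟨1, 0⟩, ⟨1, 0⟩, ⟨1, 0⟩]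

def yq : Fin 4 → QI := ![⟨1, -1⟩, ⟨1, 0⟩, ⟨1, 0⟩, ⟨1, 0⟩]

def niq : QI := ⟨1/6, 0⟩

def Aiq : Matrix (Fin 5) (Fin 5) QI :=
  !![⟨295/1824, 0⟩, ⟨-1/76, 0⟩, ⟨-47/1824, 0⟩, ⟨-7/456, 1/32⟩, ⟨-7/456, -1/32⟩;
     ⟨-1/76, 0⟩, ⟨5/38, 0⟩, ⟨-1/76, 0⟩, ⟨-1/76, 0⟩, ⟨-1/76, 0⟩;
     ⟨-47/1824, 0⟩, ⟨-1/76, 0⟩, ⟨295/1824, 0⟩, ⟨-7/456, -1/32⟩, ⟨-7/456, 1/32⟩;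
     ⟨-7/456, -1/32⟩, ⟨-1/76, 0⟩, ⟨-7/456, 1/32⟩, ⟨295/1824, 0⟩, ⟨-47/1824, 0⟩;
     ⟨-7/456, 1/32⟩, ⟨-1/76, 0⟩, ⟨-7/456, -1/32⟩, ⟨-47/1824, 0⟩, ⟨295/1824, 0⟩]

def Uq : Matrix (Fin 5) (Fin 2) QI :=
  !![⟨73/228, 7/114⟩, ⟨-35/228, 31/114⟩;
     ⟨5/38, 1/19⟩, ⟨-5/38, -1/19⟩;
     ⟨73/228, 7/114⟩, ⟨-35/228, 31/114⟩;
     ⟨35/228, -31/114⟩, ⟨-73/228, -7/114⟩;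
     ⟨35/228, -31/114⟩, ⟨-73/228, -7/114⟩]

def Vq : Matrix (Fin 2) (Fin 5) QI :=
  !![⟨73/228, -7/114⟩, ⟨5/38, -1/19⟩, ⟨73/228, -7/114⟩, ⟨35/228, 31/114⟩, ⟨35/228, 31/114⟩;
     ⟨-35/228, -31/114⟩, ⟨-5/38, 1/19⟩, ⟨-35/228, -31/114⟩, ⟨-73/228, 7/114⟩, ⟨-73/228, 7/114⟩]

def Nq : Matrix (Fin 2) (Fin 2) QI :=
  !![⟨469/114, 0⟩, ⟨253/114, 0⟩;
     ⟨253/114, 0⟩, ⟨469/114, 0⟩]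

def Hiq : Matrix (Fin 2) (Fin 2) QI :=
  !![⟨469/228, 0⟩, ⟨-253/228, 0⟩;
     ⟨-253/228, 0⟩, ⟨469/228, 0⟩]

def Kq : Matrix (Fin 2) (Fin 2) QI :=
  !![⟨2, 0⟩, ⟨-217/25992, 0⟩;
     ⟨-217/25992, 0⟩, ⟨2, 0⟩]

def U2q : Fin 4 → Matrix (Fin 5) (Fin 2) QI :=
  ![!![⟨565/12996, 3227/25992⟩, ⟨-2009/12996, 383/25992⟩;
     ⟨-25/361, -53/722⟩, ⟨25/361, 53/722⟩;
     ⟨565/12996, 3227/25992⟩, ⟨-2009/12996, 383/25992⟩;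
     ⟨2009/12996, -383/25992⟩, ⟨-565/12996, -3227/25992⟩;
     ⟨2009/12996, -383/25992⟩, ⟨-565/12996, -3227/25992⟩],
    !![⟨77641/207936, -923/69312⟩, ⟨-11939/207936, 1815/23104⟩;
     ⟨225/5776, 1139/17328⟩, ⟨-947/5776, 191/17328⟩;
     ⟨-42173/207936, 3751/69312⟩, ⟨25567/207936, -1187/23104⟩;
     ⟨2705/207936, -16693/69312⟩, ⟨-59743/207936, 333/23104⟩;
     ⟨45683/207936, -2461/23104⟩, ⟨-3085/207936, -1091/69312⟩],
    !![⟨59743/207936, -333/23104⟩, ⟨-2705/207936, 16693/69312⟩;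
     ⟨947/5776, -191/17328⟩, ⟨-225/5776, -1139/17328⟩;
     ⟨3085/207936, 1091/69312⟩, ⟨-45683/207936, 2461/23104⟩;
     ⟨-25567/207936, 1187/23104⟩, ⟨42173/207936, -3751/69312⟩;
     ⟨11939/207936, -1815/23104⟩, ⟨-77641/207936, 923/69312⟩],
    !![⟨3085/207936, 1091/69312⟩, ⟨-45683/207936, 2461/23104⟩;
     ⟨947/5776, -191/17328⟩, ⟨-225/5776, -1139/17328⟩;
     ⟨59743/207936, -333/23104⟩, ⟨-2705/207936, 16693/69312⟩;
     ⟨11939/207936, -1815/23104⟩, ⟨-77641/207936, 923/69312⟩;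
     ⟨-25567/207936, 1187/23104⟩, ⟨42173/207936, -3751/69312⟩]]

def V2q : Fin 4 → Matrix (Fin 2) (Fin 5) QI :=
  ![!![⟨965/12996, 2003/25992⟩, ⟨-20/361, -17/722⟩, ⟨965/12996, 2003/25992⟩, ⟨-479/12996, -1607/25992⟩, ⟨-479/12996, -1607/25992⟩;
     ⟨479/12996, 1607/25992⟩, ⟨20/361, 17/722⟩, ⟨479/12996, 1607/25992⟩, ⟨-965/12996, -2003/25992⟩, ⟨-965/12996, -2003/25992⟩],
    !![⟨-31/3648, -5081/51984⟩, ⟨71/912, 87/5776⟩, ⟨-485/3648, 1421/25992⟩, ⟨8/57, 19823/207936⟩, ⟨-67/912, -12211/207936⟩;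
     ⟨-17/192, -3283/25992⟩, ⟨35/912, 179/5776⟩, ⟨69/1216, 7171/51984⟩, ⟨45/304, -9373/207936⟩, ⟨-21/152, 1001/207936⟩],
    !![⟨-45/304, 9373/207936⟩, ⟨-35/912, -179/5776⟩, ⟨21/152, -1001/207936⟩, ⟨-69/1216, -7171/51984⟩, ⟨17/192, 3283/25992⟩;
     ⟨-8/57, -19823/207936⟩, ⟨-71/912, -87/5776⟩, ⟨67/912, 12211/207936⟩, ⟨485/3648, -1421/25992⟩, ⟨31/3648, 5081/51984⟩],
    !![⟨21/152, -1001/207936⟩, ⟨-35/912, -179/5776⟩, ⟨-45/304, 9373/207936⟩, ⟨17/192, 3283/25992⟩, ⟨-69/1216, -7171/51984⟩;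
     ⟨67/912, 12211/207936⟩, ⟨-71/912, -87/5776⟩, ⟨-8/57, -19823/207936⟩, ⟨31/3648, 5081/51984⟩, ⟨485/3648, -1421/25992⟩]]

def N1q : Fin 4 → Matrix (Fin 2) (Fin 2) QI :=
  ![!![⟨1215/722, -14027/12996⟩, ⟨951/722, -2579/12996⟩;
     ⟨951/722, -2579/12996⟩, ⟨1215/722, -14027/12996⟩],
    !![⟨140005/51984, -2143/51984⟩, ⟨75265/51984, 19661/51984⟩;
     ⟨58393/51984, -48739/51984⟩, ⟨108997/51984, -13543/51984⟩],
    !![⟨108997/51984, -13543/51984⟩, ⟨58393/51984, -48739/51984⟩;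
     ⟨75265/51984, 19661/51984⟩, ⟨140005/51984, -2143/51984⟩],
    !![⟨108997/51984, -13543/51984⟩, ⟨58393/51984, -48739/51984⟩;
     ⟨75265/51984, 19661/51984⟩, ⟨140005/51984, -2143/51984⟩]]

def N2q : Fin 4 → Matrix (Fin 2) (Fin 2) QI :=
  ![!![⟨1215/722, 14027/12996⟩, ⟨951/722, 2579/12996⟩;
     ⟨951/722, 2579/12996⟩, ⟨1215/722, 14027/12996⟩],
    !![⟨140005/51984, 2143/51984⟩, ⟨58393/51984, 48739/51984⟩;
     ⟨75265/51984, -19661/51984⟩, ⟨108997/51984, 13543/51984⟩],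
    !![⟨108997/51984, 13543/51984⟩, ⟨75265/51984, -19661/51984⟩;
     ⟨58393/51984, 48739/51984⟩, ⟨140005/51984, 2143/51984⟩],
    !![⟨108997/51984, 13543/51984⟩, ⟨75265/51984, -19661/51984⟩;
     ⟨58393/51984, 48739/51984⟩, ⟨140005/51984, 2143/51984⟩]]

def HAq : Fin 4 → Matrix (Fin 2) (Fin 2) QI :=
  ![!![⟨12959/77976, -1279/19494⟩, ⟨12311/77976, 557/19494⟩;
     ⟨12311/77976, 557/19494⟩, ⟨12959/77976, -1279/19494⟩],
    !![⟨34787/103968, -2143/311904⟩, ⟨18679/103968, 19661/311904⟩;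
     ⟨13055/103968, -48739/311904⟩, ⟨24451/103968, -13543/311904⟩],
    !![⟨24451/103968, -13543/311904⟩, ⟨13055/103968, -48739/311904⟩;
     ⟨18679/103968, 19661/311904⟩, ⟨34787/103968, -2143/311904⟩],
    !![⟨24451/103968, -13543/311904⟩, ⟨13055/103968, -48739/311904⟩;
     ⟨18679/103968, 19661/311904⟩, ⟨34787/103968, -2143/311904⟩]]

def HBq : Fin 4 → Matrix (Fin 2) (Fin 2) QI :=
  ![!![⟨12959/77976, 1279/19494⟩, ⟨12311/77976, -557/19494⟩;
     ⟨12311/77976, -557/19494⟩, ⟨12959/77976, 1279/19494⟩],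
    !![⟨34787/103968, 2143/311904⟩, ⟨13055/103968, 48739/311904⟩;
     ⟨18679/103968, -19661/311904⟩, ⟨24451/103968, 13543/311904⟩],
    !![⟨24451/103968, 13543/311904⟩, ⟨18679/103968, -19661/311904⟩;
     ⟨13055/103968, 48739/311904⟩, ⟨34787/103968, 2143/311904⟩],
    !![⟨24451/103968, 13543/311904⟩, ⟨18679/103968, -19661/311904⟩;
     ⟨13055/103968, 48739/311904⟩, ⟨34787/103968, 2143/311904⟩]]

def HABq : Fin 4 → Fin 4 → Matrix (Fin 2) (Fin 2) QI :=
  ![![!![⟨8897/555579, 0⟩, ⟨-2038/555579, 0⟩;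
     ⟨-2038/555579, 0⟩, ⟨8897/555579, 0⟩],
    !![⟨1300891/8889264, -524209/8889264⟩, ⟨418067/4444632, 117847/4444632⟩;
     ⟨72953/1111158, 997/4444632⟩, ⟨105259/8889264, 12161/8889264⟩],
    !![⟨105259/8889264, 12161/8889264⟩, ⟨72953/1111158, 997/4444632⟩;
     ⟨418067/4444632, 117847/4444632⟩, ⟨1300891/8889264, -524209/8889264⟩],
    !![⟨105259/8889264, 12161/8889264⟩, ⟨72953/1111158, 997/4444632⟩;
     ⟨418067/4444632, 117847/4444632⟩, ⟨1300891/8889264, -524209/8889264⟩]],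
    ![!![⟨1300891/8889264, 524209/8889264⟩, ⟨72953/1111158, -997/4444632⟩;
     ⟨418067/4444632, -117847/4444632⟩, ⟨105259/8889264, -12161/8889264⟩],
    !![⟨18881011/142228224, 0⟩, ⟨6764011/142228224, 715/77976⟩;
     ⟨6764011/142228224, -715/77976⟩, ⟨9916051/142228224, 0⟩],
    !![⟨7200223/35557056, 12385/131328⟩, ⟨3006007/35557056, 36083/277248⟩;
     ⟨1044979/35557056, 23011/277248⟩, ⟨13435/35557056, 51587/2495232⟩],
    !![⟨13435/35557056, -51587/2495232⟩, ⟨3006007/35557056, -36083/277248⟩;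
     ⟨1044979/35557056, -23011/277248⟩, ⟨7200223/35557056, -12385/131328⟩]],
    ![!![⟨105259/8889264, -12161/8889264⟩, ⟨418067/4444632, -117847/4444632⟩;
     ⟨72953/1111158, -997/4444632⟩, ⟨1300891/8889264, 524209/8889264⟩],
    !![⟨7200223/35557056, -12385/131328⟩, ⟨1044979/35557056, -23011/277248⟩;
     ⟨3006007/35557056, -36083/277248⟩, ⟨13435/35557056, -51587/2495232⟩],
    !![⟨9916051/142228224, 0⟩, ⟨6764011/142228224, -715/77976⟩;
     ⟨6764011/142228224, 715/77976⟩, ⟨18881011/142228224, 0⟩],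
    !![⟨26637685/142228224, 0⟩, ⟨10987597/142228224, -28505/155952⟩;
     ⟨10987597/142228224, 28505/155952⟩, ⟨18239989/142228224, 0⟩]],
    ![!![⟨105259/8889264, -12161/8889264⟩, ⟨418067/4444632, -117847/4444632⟩;
     ⟨72953/1111158, -997/4444632⟩, ⟨1300891/8889264, 524209/8889264⟩],
    !![⟨13435/35557056, 51587/2495232⟩, ⟨1044979/35557056, 23011/277248⟩;
     ⟨3006007/35557056, 36083/277248⟩, ⟨7200223/35557056, 12385/131328⟩],
    !![⟨26637685/142228224, 0⟩, ⟨10987597/142228224, -28505/155952⟩;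
     ⟨10987597/142228224, 28505/155952⟩, ⟨18239989/142228224, 0⟩],
    !![⟨9916051/142228224, 0⟩, ⟨6764011/142228224, -715/77976⟩;
     ⟨6764011/142228224, 715/77976⟩, ⟨18881011/142228224, 0⟩]]]


def phi : QI →+* ℂ where
  toFun z := (z.re : ℂ) + (z.im : ℂ) * Complex.I
  map_one' := by
    change ((1 : ℚ) : ℂ) + ((0 : ℚ) : ℂ) * Complex.I = 1
    simp
  map_zero' := by
    change ((0 : ℚ) : ℂ) + ((0 : ℚ) : ℂ) * Complex.I = 0
    simp
  map_add' a b := by simp; ring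
  map_mul' a b := by
    simp only [QuadraticAlgebra.re_mul, QuadraticAlgebra.im_mul]
    push_cast
    linear_combination (-(a.im : ℂ) * b.im) * Complex.I_sq

lemma phi_apply (z : QI) : phi z = (z.re : ℂ) + (z.im : ℂ) * Complex.I := rfl

/-- coordinatewise image of a Gaussian rational vector -/
def pv (x : Fin 4 → QI) : Fin 4 → ℂ := fun i => phi (x i)

lemma pv_sh (α : Fin 4) (x : Fin 4 → QI) : sh α (pv x) = pv (sh α x) := by
  funext i
  by_cases h : i = α
  · subst h; simp [sh, pv]
  · simp [sh, pv, h]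

lemma map_nu (x y : Fin 4 → QI) : nuR (pv x) (pv y) = phi (nuR x y) := by
  simp [nuR, pv]

lemma map_A (x y : Fin 4 → QI) : AR (pv x) (pv y) = (AR x y).map phi := by
  ext i j
  fin_cases i <;> fin_cases j <;> simp [AR, map_nu] <;> simp [pv]

lemma map_B (x y : Fin 4 → QI) : BR (pv x) (pv y) = (BR x y).map phi := by
  ext i j
  fin_cases i <;> fin_cases j <;> simp [BR, pv]

lemma map_C (x y : Fin 4 → QI) : CR (pv x) (pv y) = (CR x y).map phi := by
  ext i j
  fin_cases i <;> fin_cases j <;> simp [CR, pv]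

lemma map_D (x y : Fin 4 → QI) : DR (pv x) (pv y) = (DR x y).map phi := by
  simp only [DR, map_B]; rfl

section maps

variable {m n : Type*} {F : (Fin 4 → ℂ) → (Fin 4 → ℂ) → Matrix m n ℂ}
  {G : (Fin 4 → QI) → (Fin 4 → QI) → Matrix m n QI}

lemma map_dx (h : ∀ x y, F (pv x) (pv y) = (G x y).map phi) (α : Fin 4) (x y : Fin 4 → QI) :
    dx α F (pv x) (pv y) = (dx α G x y).map phi := by
  simp only [dx, pv_sh, h]; ext i j; simp

lemma map_dy (h : ∀ x y, F (pv x) (pv y) = (G x y).map phi) (α : Fin 4) (x y : Fin 4 → QI) :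
    dy α F (pv x) (pv y) = (dy α G x y).map phi := by
  simp only [dy, pv_sh, h]; ext i j; simp

end maps

lemma map_dxn (α : Fin 4) (x y : Fin 4 → QI) :
    dx α nuR (pv x) (pv y) = phi (dx α nuR x y) := by
  simp only [dx, pv_sh, map_nu, map_sub]

lemma map_dyn (α : Fin 4) (x y : Fin 4 → QI) :
    dy α nuR (pv x) (pv y) = phi (dy α nuR x y) := by
  simp only [dy, pv_sh, map_nu, map_sub]

lemma map_dydxn (α β : Fin 4) (x y : Fin 4 → QI) :
    dy β (dx α nuR) (pv x) (pv y) = phi (dy β (dx α nuR) x y) := by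
  simp only [dy, pv_sh, map_dxn, map_sub]

lemma map_mm {l m n : Type*} [Fintype m] (A : Matrix l m QI) (B : Matrix m n QI) :
    A.map phi * B.map phi = (A * B).map phi := (Matrix.map_mul).symm

lemma map_ms {m n : Type*} (A B : Matrix m n QI) :
    A.map phi - B.map phi = (A - B).map phi := by ext i j; simp

lemma map_ma {m n : Type*} (A B : Matrix m n QI) :
    A.map phi + B.map phi = (A + B).map phi := by ext i j; simp

lemma map_sc {m n : Type*} (a : QI) (B : Matrix m n QI) :
    phi a • B.map phi = (a • B).map phi := by ext i j; simp

lemma map_N1 (C1 : Matrix (Fin 2) (Fin 2) QI) (D1 V : Matrix (Fin 2) (Fin 5) QI)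
    (A1 : Matrix (Fin 5) (Fin 5) QI) (B1 U : Matrix (Fin 5) (Fin 2) QI) :
    N1 (C1.map phi) (D1.map phi) (V.map phi) (A1.map phi) (B1.map phi) (U.map phi)
      = (N1 C1 D1 V A1 B1 U).map phi := by
  simp only [N1, map_mm, map_ms]

lemma map_N12 (C12 : Matrix (Fin 2) (Fin 2) QI) (D1 D12 V V2 : Matrix (Fin 2) (Fin 5) QI)
    (A1 A12 : Matrix (Fin 5) (Fin 5) QI) (B1 B12 U U2 : Matrix (Fin 5) (Fin 2) QI) :
    N12 (C12.map phi) (D1.map phi) (D12.map phi) (V.map phi) (V2.map phi) (A1.map phi)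
      (A12.map phi) (B1.map phi) (B12.map phi) (U.map phi) (U2.map phi)
      = (N12 C12 D1 D12 V V2 A1 A12 B1 B12 U U2).map phi := by
  simp only [N12, map_mm, map_ms, map_ma]

/-! Computations with Gaussian rationals. -/

lemma q_A : AR xq yq * Aiq = 1 := by decide +kernel
lemma q_n : nuR xq yq * niq = 1 := by decide +kernel
lemma q_U : Aiq * BR xq yq = Uq := by decide +kernel
lemma q_V : DR xq yq * Aiq = Vq := by decide +kernel
lemma q_N : CR xq yq - DR xq yq * Uq = Nq := by decide +kernel
lemma q_H : (niq • Nq) * Hiq = 1 := by decide +kernel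
lemma q_U2 : ∀ β, Aiq * (dy β BR xq yq - dy β AR xq yq * Uq) = U2q β := by decide +kernel
lemma q_V2 : ∀ β, (dy β DR xq yq - Vq * dy β AR xq yq) * Aiq = V2q β := by decide +kernel
lemma q_N1 : ∀ α, N1 (dx α CR xq yq) (dx α DR xq yq) Vq (dx α AR xq yq) (dx α BR xq yq) Uq
    = N1q α := by decide +kernel
lemma q_N2 : ∀ α, N1 (dy α CR xq yq) (dy α DR xq yq) Vq (dy α AR xq yq) (dy α BR xq yq) Uq
    = N2q α := by decide +kernel
lemma q_HA : ∀ α, niq • N1q α - (niq * niq * dx α nuR xq yq) • Nq = HAq α := by decide +kernel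
lemma q_HB : ∀ α, niq • N2q α - (niq * niq * dy α nuR xq yq) • Nq = HBq α := by decide +kernel
lemma q_HAB : ∀ α β, niq • N12 (dy β (dx α CR) xq yq) (dx α DR xq yq) (dy β (dx α DR) xq yq)
      Vq (V2q β) (dx α AR xq yq) (dy β (dx α AR) xq yq) (dx α BR xq yq)
      (dy β (dx α BR) xq yq) Uq (U2q β)
    - (niq * niq) • (dy β nuR xq yq • N1q α + dx α nuR xq yq • N2q β)
    + (2 * niq * niq * niq * dx α nuR xq yq * dy β nuR xq yq
      - niq * niq * dy β (dx α nuR) xq yq) • Nq = HABq α β := by decide +kernel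
def KqF : Matrix (Fin 2) (Fin 2) QI := fun i j => -∑ α : Fin 4, ∑ β : Fin 4,
    (nuR xq yq * ((if α = β then 1 else 0) + yq β * xq α)) *
      ((∑ k : Fin 2, HABq α β i k * Hiq k j)
        - ∑ k : Fin 2, ∑ l : Fin 2, ∑ m : Fin 2,
            HAq α i k * Hiq k l * HBq β l m * Hiq m j)

lemma q_K : KqF = Kq := by decide +kernel

/-! Transfer to the complex numbers. -/

lemma c_n : (nuR (pv xq) (pv yq))⁻¹ = phi niq := by
  rw [map_nu]
  refine inv_eq_of_mul_eq_one_right ?_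
  rw [← map_mul, q_n, map_one]

lemma c_n0 : nuR (pv xq) (pv yq) ≠ 0 := by
  rw [map_nu]
  refine left_ne_zero_of_mul_eq_one (b := phi niq) ?_
  rw [← map_mul, q_n, map_one]

lemma c_AA : AR (pv xq) (pv yq) * Aiq.map phi = 1 := by
  rw [map_A, map_mm, q_A]; ext i j; simp [Matrix.one_apply, apply_ite phi]

lemma c_A : (AR (pv xq) (pv yq))⁻¹ = Aiq.map phi := Matrix.inv_eq_right_inv c_AA

lemma c_A0 : (AR (pv xq) (pv yq)).det ≠ 0 := by
  have := congrArg Matrix.det c_AA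
  rw [Matrix.det_mul, Matrix.det_one] at this
  exact left_ne_zero_of_mul_eq_one this

lemma c_U : Uc (pv xq) (pv yq) = Uq.map phi := by rw [Uc, c_A, map_B, map_mm, q_U]
lemma c_V : Vc (pv xq) (pv yq) = Vq.map phi := by rw [Vc, c_A, map_D, map_mm, q_V]
lemma c_N : Nc (pv xq) (pv yq) = Nq.map phi := by
  have := c_U
  rw [Uc] at this
  rw [Nc, Matrix.mul_assoc, this, map_C, map_D, map_mm, map_ms, q_N]
lemma c_H : Hhat (pv xq) (pv yq) = (niq • Nq).map phi := by rw [Hhat_eq, c_n, c_N, map_sc]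
lemma c_HH : Hhat (pv xq) (pv yq) * Hiq.map phi = 1 := by
  rw [c_H, map_mm, q_H]; ext i j; simp [Matrix.one_apply, apply_ite phi]
lemma c_Hi : (Hhat (pv xq) (pv yq))⁻¹ = Hiq.map phi := Matrix.inv_eq_right_inv c_HH
lemma c_U2 (β : Fin 4) : U2c β (pv xq) (pv yq) = (U2q β).map phi := by
  rw [U2c, c_A, c_U, map_dy map_A, map_dy map_B, map_mm, map_ms, map_mm, q_U2]
lemma c_V2 (β : Fin 4) : V2c β (pv xq) (pv yq) = (V2q β).map phi := by
  rw [V2c, c_A, c_V, map_dy map_A, map_dy map_D, map_mm, map_ms, map_mm, q_V2]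
lemma c_N1 (α : Fin 4) : N1c α (pv xq) (pv yq) = (N1q α).map phi := by
  rw [N1c, c_U, c_V, map_dx map_A, map_dx map_B, map_dx map_C, map_dx map_D, map_N1, q_N1]
lemma c_N2 (α : Fin 4) : N2c α (pv xq) (pv yq) = (N2q α).map phi := by
  rw [N2c, c_U, c_V, map_dy map_A, map_dy map_B, map_dy map_C, map_dy map_D, map_N1, q_N2]

lemma c_HA (α : Fin 4) (i j : Fin 2) : dH α (pv xq) (pv yq) i j = phi (HAq α i j) := by
  have h := dH_eq α c_n0 c_A0
  rw [c_n, c_N, c_N1, map_dxn, ← map_mul, ← map_mul, map_sc, map_sc, map_ms, q_HA] at h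
  exact congrFun (congrFun h i) j

lemma c_HB (β : Fin 4) (i j : Fin 2) : dbH β (pv xq) (pv yq) i j = phi (HBq β i j) := by
  have h := (MD_Hy β c_n0 c_A0 i j).deriv
  rw [c_n, c_N, c_N2, map_dyn, ← map_mul, ← map_mul, map_sc, map_sc, map_ms, q_HB] at h
  exact h

lemma c_HAB (α β : Fin 4) (i j : Fin 2) : ddH α β (pv xq) (pv yq) i j = phi (HABq α β i j) := by
  have h := (MD_Hxy α β c_n0 c_A0 i j).deriv
  rw [N12c, c_U, c_V, c_U2, c_V2, map_dx map_A, map_dx map_B, map_dx map_D,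
    map_dy (map_dx map_A α), map_dy (map_dx map_B α), map_dy (map_dx map_C α),
    map_dy (map_dx map_D α), map_N12,
    c_n, c_N, c_N1, c_N2, map_dxn, map_dyn, map_dydxn, ← map_ofNat phi 2] at h
  simp only [← map_mul, ← map_sub, map_sc, map_ma, map_ms] at h
  rw [q_HAB] at h
  exact h

lemma x_eq : (![1 + Complex.I, 1, 1, 1] : Fin 4 → ℂ) = (pv xq) := by
  funext i
  fin_cases i <;> simp [pv, xq, phi_apply]

lemma y_eq : cconj (pv xq) = (pv yq) := by
  rw [← x_eq]
  funext i
  fin_cases i <;> simp [pv, yq, phi_apply, cconj]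

lemma star_X (i : Fin 4) : star ((pv xq) i) = (pv yq) i := congrFun y_eq i

lemma c_K : Kmat (pv xq) = Kq.map phi := by
  ext i j
  have h := congrArg phi (congrFun (congrFun q_K i) j)
  rw [Matrix.map_apply, ← h, KqF]
  simp only [Kmat, Matrix.of_apply, y_eq, c_Hi, c_HA, c_HB, c_HAB, gUp, nu_eq, star_X, map_nu,
    Matrix.map_apply]
  simp [pv, apply_ite phi]

/-- at x² = (1+i,1,1,1), ν ≠ 0, Â and H = Ĥ(x², conj x²) are
invertible, all the partial derivatives of Ĥ involved exist at (x², conj x²),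
and the mean curvature satisfies K(x²) = [[2, −217/25992],[−217/25992, 2]];
in particular K(x²) ≠ 2·I₂, so the natural metric of the Horrocks–Mumford
bundle twist E(−2) does not satisfy the Hermitian–Einstein equation K = 2·id
at x². -/
theorem horrocks_mumford_stmt13 :
    let x2 : Fin 4 → ℂ := ![1 + Complex.I, 1, 1, 1]
    nu x2 (cconj x2) ≠ 0 ∧
    IsUnit (Ahat x2 (cconj x2)) ∧
    IsUnit (Hhat x2 (cconj x2)) ∧
    (∀ (α : Fin 4) (i j : Fin 2),
      DifferentiableAt ℂ (fun t : ℂ => Hhat (x2 + t • (Pi.single α 1 : Fin 4 → ℂ)) (cconj x2) i j) 0) ∧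
    (∀ (β : Fin 4) (i j : Fin 2),
      DifferentiableAt ℂ (fun s : ℂ => Hhat x2 (cconj x2 + s • (Pi.single β 1 : Fin 4 → ℂ)) i j) 0) ∧
    (∀ (α β : Fin 4) (i j : Fin 2),
      DifferentiableAt ℂ (fun s : ℂ => dH α x2 (cconj x2 + s • (Pi.single β 1 : Fin 4 → ℂ)) i j) 0) ∧
    Kmat x2 = !![(2 : ℂ), -217 / 25992; -217 / 25992, 2] ∧
    Kmat x2 ≠ (2 : ℂ) • (1 : Matrix (Fin 2) (Fin 2) ℂ) := by
  intro x2
  have hx : x2 = (pv xq) := x_eq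
  rw [hx, y_eq]
  have hK : Kmat (pv xq) = !![(2 : ℂ), -217 / 25992; -217 / 25992, 2] := by
    rw [c_K]
    ext i j
    fin_cases i <;> fin_cases j <;> simp [Kq, phi_apply]
  refine ⟨c_n0, ?_, ?_, ?_, ?_, ?_, hK, ?_⟩
  · exact (Matrix.isUnit_iff_isUnit_det _).2 (isUnit_iff_ne_zero.2 c_A0)
  · exact IsUnit.of_mul_eq_one _ c_HH
  · exact fun α i j => (MD_Hx α c_n0 c_A0 i j).differentiableAt
  · exact fun β i j => (MD_Hy β c_n0 c_A0 i j).differentiableAt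
  · exact fun α β i j => (MD_Hxy α β c_n0 c_A0 i j).differentiableAt
  · rw [hK]
    intro h
    have := congrFun (congrFun h 0) 1
    norm_num at this
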